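/- Let a, b, c, d be positive integers with a > c and b > d, and let T : ℝ² → ℤ be the tile obtained by removing a c×d rectangle from the upper right corner of an a×b rectangle, i.e. T = 𝟙_{[0,a)×[0,b)} − 𝟙_{[a−c,a)×[b−d,b)}. Then T ℤ-shapetiles a square. -/

import Mathlib

open Finset

/-- Indicator (with value 1) of the rectangle `[b1,b2) × [c1,c2)`, ℤ-valued. -/
noncomputable def rectIndZ (b1 b2 c1 c2 : ℝ) (p : ℝ × ℝ) : ℤ :=
  if b1 ≤ p.1 ∧ p.1 < b2 ∧ c1 ≤ p.2 ∧ p.2 < c2 then 1 else 0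

/-- `T` ℤ-shapetiles a square. -/
noncomputable def ZShapeTilesSquare (T : ℝ × ℝ → ℤ) : Prop :=
  ∃ (s : ℝ), 0 < s ∧
    ∃ (n : ℕ) (a : Fin n → ℤ) (ρ : Fin n → ℝ) (v : Fin n → ℝ × ℝ),
      (∀ i, 0 < ρ i) ∧
      ∀ p : ℝ × ℝ, rectIndZ 0 s 0 s p =
        ∑ i, a i * T ((p.1 - (v i).1) / ρ i, (p.2 - (v i).2) / ρ i)

/-- A vanishing exponential sum `∑ εᵢ mᵢᵏ` stays zero after isolating one of its terms. -/
theorem mul_prod_sub_eq_zero_of_forall_sum_pow {ι A : Type*} [DecidableEq ι] [CommRing A]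
    (s : Finset ι) (ε m : ι → A) (h : ∀ k, 0 < k → ∑ i ∈ s, ε i * m i ^ k = 0)
    {j : ι} (hj : j ∈ s) : ε j * (m j * ∏ i ∈ s.erase j, (m j - m i)) = 0 := by
  have key : ∀ p : Polynomial A, ∑ i ∈ s, ε i * (m i * p.eval (m i)) = 0 := by
    intro p
    induction p using Polynomial.induction_on' with
    | add p q hp hq =>
      simp only [Polynomial.eval_add, mul_add, Finset.sum_add_distrib, hp, hq, add_zero]
    | monomial n a =>
      have := h (n + 1) n.succ_pos
      calc ∑ i ∈ s, ε i * (m i * (Polynomial.monomial n a).eval (m i))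
          = a * ∑ i ∈ s, ε i * m i ^ (n + 1) := by
            rw [Finset.mul_sum]
            refine Finset.sum_congr rfl fun i _ => ?_
            rw [Polynomial.eval_monomial]
            ring
        _ = 0 := by rw [this, mul_zero]
  have := key (∏ i ∈ s.erase j, (Polynomial.X - Polynomial.C (m i)))
  rw [Finset.sum_eq_single_of_mem j hj] at this
  · simpa [Polynomial.eval_prod] using this
  · intro i hi hij
    rw [Polynomial.eval_prod, Finset.prod_eq_zero (Finset.mem_erase.2 ⟨hij, hi⟩) (by simp)]
    simp

theorem sum_range_mul_pow_of_pow_eq_one {A : Type*} [CommRing A] {X : A} {q : ℕ}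
    (h : X ^ q = 1) (n : ℕ) :
    ∑ i ∈ range (q * n), X ^ i = n * ∑ i ∈ range q, X ^ i := by
  induction n with
  | zero => simp
  | succ n ih =>
    rw [Nat.mul_succ, Finset.sum_range_add, ih]
    simp only [pow_add, pow_mul, h, one_pow, one_mul]
    push_cast
    ring

/-- A unipotent element has a vanishing geometric sum if some positive integer is nilpotent. -/
theorem exists_geom_sum_eq_zero {A : Type*} [CommRing A] {X : A} {n : ℕ} (hn : 0 < n)
    (hX : IsNilpotent (X - 1)) (hn' : IsNilpotent (n : A)) :
    ∃ Q, 0 < Q ∧ ∑ i ∈ range Q, X ^ i = 0 := by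
  obtain ⟨m, hm⟩ := hn'
  obtain ⟨l, hl⟩ := hX
  have hN : ((n ^ m : ℕ) : A) = 0 := by exact_mod_cast hm
  have hNpos : 0 < n ^ m := pow_pos hn m
  generalize n ^ m = N at hN hNpos
  have hdvd : ∀ j : ℕ, (X - 1) ^ (j + 1) ∣ X ^ N ^ j - 1 := by
    intro j
    induction j with
    | zero => simp
    | succ j ih =>
      have h1 : X ^ N ^ j - 1 ∣ ∑ i ∈ range N, (X ^ N ^ j) ^ i := by
        have : ∑ i ∈ range N, (X ^ N ^ j) ^ i = ∑ i ∈ range N, ((X ^ N ^ j) ^ i - 1) := by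
          simp [Finset.sum_sub_distrib, hN]
        rw [this]
        exact Finset.dvd_sum fun i _ => sub_one_dvd_pow_sub_one _ i
      have h2 : X - 1 ∣ X ^ N ^ j - 1 := (dvd_pow_self _ j.succ_ne_zero).trans ih
      rw [pow_succ N, pow_mul, ← geom_sum_mul, mul_comm, pow_succ (X - 1)]
      exact mul_dvd_mul ih (h2.trans h1)
  have hone : X ^ N ^ l = 1 := by
    have := hdvd l
    rw [pow_succ, hl, zero_mul, zero_dvd_iff] at this
    exact sub_eq_zero.1 this
  exact ⟨N ^ l * N, by positivity, by
    rw [sum_range_mul_pow_of_pow_eq_one hone, hN, zero_mul]⟩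

theorem pow_eq_one_of_pow_mul_pow_eq_one {A : Type*} [CommRing A] {x y : A} {p q u v N : ℕ}
    (h1 : x ^ p * y ^ q = 1) (h2 : x ^ u = y ^ v) (hN : p * v + u * q ∣ N) :
    x ^ N = 1 ∧ y ^ N = 1 := by
  obtain ⟨t, rfl⟩ := hN
  constructor
  · have : x ^ (p * v + u * q) = (x ^ p * y ^ q) ^ v := by
      rw [pow_add, pow_mul x u, h2]
      ring
    rw [pow_mul, this, h1, one_pow, one_pow]
  · have : y ^ (p * v + u * q) = (x ^ p * y ^ q) ^ u := by
      rw [pow_add, mul_comm p v, pow_mul y v, ← h2]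
      ring
    rw [pow_mul, this, h1, one_pow, one_pow]

/-- The relations satisfied by `x, y` in a domain force them to be roots of unity. -/
theorem pow_factorial_eq_one {D : Type*} [CommRing D] [IsDomain D] {x y : D} {e g c d : ℕ}
    (he : 0 < e) (hg : 0 < g) (hc : 0 < c)
    (hα : (1 - x ^ (e + c) * y ^ g) * (1 - x ^ e * y ^ (g + d)) * (1 - x ^ e * y ^ g) = 0)
    (hβ : (x ^ (e + c) - y ^ (g + d)) * (x ^ c - y ^ (g + d)) * (x ^ c - y ^ g) = 0) :
    x ^ (2 * ((e + c) * (g + d))).factorial = 1 ∧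
      y ^ (2 * ((e + c) * (g + d))).factorial = 1 := by
  have hdvd : ∀ p q u v, 0 < p → 0 < v → p ≤ e + c → u ≤ e + c → q ≤ g + d → v ≤ g + d →
      p * v + u * q ∣ (2 * ((e + c) * (g + d))).factorial := by
    intro p q u v hp hv hpe hue hqg hvg
    have := Nat.mul_le_mul hpe hvg
    have := Nat.mul_le_mul hue hqg
    have := Nat.mul_pos hp hv
    exact Nat.dvd_factorial (by omega) (by omega)
  simp only [mul_eq_zero, sub_eq_zero] at hα hβ
  rcases hα with (hα | hα) | hα <;> rcases hβ with (hβ | hβ) | hβ <;>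
    exact pow_eq_one_of_pow_mul_pow_eq_one hα.symm hβ (hdvd _ _ _ _
      (by omega) (by omega) (by omega) (by omega) (by omega) (by omega))

/-- If all integer rescalings of a notched rectangle vanish, then so does some square. -/
theorem exists_one_sub_pow_mul_one_sub_pow_eq_zero {A : Type*} [CommRing A] {x y : A}
    (hx : IsUnit x) {e g c d : ℕ} (he : 0 < e) (hg : 0 < g) (hc : 0 < c)
    (h : ∀ k, 0 < k → (1 - x ^ (k * (e + c))) * (1 - y ^ (k * (g + d))) -
      x ^ (k * e) * y ^ (k * g) * ((1 - x ^ (k * c)) * (1 - y ^ (k * d))) = 0) :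
    ∃ s, 0 < s ∧ (1 - x ^ s) * (1 - y ^ s) = 0 := by
  set ε : Fin 6 → A := ![1, -1, -1, 1, 1, -1] with hε
  set m : Fin 6 → A := ![1, x ^ (e + c), y ^ (g + d), x ^ (e + c) * y ^ g, x ^ e * y ^ (g + d),
    x ^ e * y ^ g] with hm
  have hsum : ∀ k, 0 < k → ∑ i, ε i * m i ^ k = 0 := by
    intro k hk
    rw [← h k hk]
    simp only [hε, hm, Fin.sum_univ_six, Matrix.cons_val]
    ring
  have h0 := mul_prod_sub_eq_zero_of_forall_sum_pow univ ε m hsum (mem_univ 0)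
  have h1 := mul_prod_sub_eq_zero_of_forall_sum_pow univ ε m hsum (mem_univ 1)
  rw [show (univ : Finset (Fin 6)).erase 0 = {1, 2, 3, 4, 5} by decide] at h0
  rw [show (univ : Finset (Fin 6)).erase 1 = {0, 2, 3, 4, 5} by decide] at h1
  simp [hε, hm] at h0 h1
  have hα : (1 - x ^ (e + c)) * (1 - y ^ (g + d)) * ((1 - x ^ (e + c) * y ^ g) *
      (1 - x ^ e * y ^ (g + d)) * (1 - x ^ e * y ^ g)) = 0 := by
    linear_combination h0
  have hβ : (1 - x ^ (e + c)) * (1 - y ^ g) * ((x ^ (e + c) - y ^ (g + d)) *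
      (x ^ c - y ^ (g + d)) * (x ^ c - y ^ g)) = 0 := by
    have hu : IsUnit (x ^ (e + c) * x ^ (e + c) * x ^ e * x ^ e) :=
      (((hx.pow _).mul (hx.pow _)).mul (hx.pow _)).mul (hx.pow _)
    refine hu.mul_right_eq_zero.1 ?_
    linear_combination -h1
  set M := (2 * ((e + c) * (g + d))).factorial with hMdef
  have hM : 0 < M := Nat.factorial_pos _
  have hle1 : e + c ≤ (e + c) * (g + d) := Nat.le_mul_of_pos_right _ (by omega)
  have hle2 : g + d ≤ (e + c) * (g + d) := Nat.le_mul_of_pos_left _ (by omega)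
  have hdvd : ∀ z : A, ∀ n, 0 < n → n ≤ 2 * ((e + c) * (g + d)) → 1 - z ^ n ∣ 1 - z ^ M := by
    intro z n hn hle
    obtain ⟨t, ht⟩ := Nat.dvd_factorial hn hle
    rw [hMdef, ht, pow_mul]
    exact one_sub_dvd_one_sub_pow _ t
  have hfM := h M hM
  simp only [pow_mul] at hfM
  set X := x ^ M with hX
  set Y := y ^ M with hY
  set J : Ideal A := LinearMap.ker (LinearMap.toSpanSingleton A A ((1 - X) * (1 - Y))) with hJ
  have memJ : ∀ z, z ∈ J ↔ (1 - X) * (1 - Y) * z = 0 := by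
    intro z
    rw [hJ, LinearMap.mem_ker, LinearMap.toSpanSingleton_apply, smul_eq_mul, mul_comm]
  have hαJ : (1 - x ^ (e + c) * y ^ g) * (1 - x ^ e * y ^ (g + d)) * (1 - x ^ e * y ^ g) ∈ J := by
    rw [memJ]
    exact zero_dvd_iff.1 (hα ▸ mul_dvd_mul_right (mul_dvd_mul
      (hdvd x (e + c) (by omega) (by omega)) (hdvd y (g + d) (by omega) (by omega))) _)
  have hβJ : (x ^ (e + c) - y ^ (g + d)) * (x ^ c - y ^ (g + d)) * (x ^ c - y ^ g) ∈ J := by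
    rw [memJ]
    exact zero_dvd_iff.1 (hβ ▸ mul_dvd_mul_right (mul_dvd_mul
      (hdvd x (e + c) (by omega) (by omega)) (hdvd y g (by omega) (by omega))) _)
  have hpJ : (∑ i ∈ range (e + c), X ^ i) * (∑ i ∈ range (g + d), Y ^ i) -
      X ^ e * Y ^ g * ((∑ i ∈ range c, X ^ i) * ∑ i ∈ range d, Y ^ i) ∈ J := by
    rw [memJ, ← hfM, ← mul_neg_geom_sum X (e + c), ← mul_neg_geom_sum X c,
      ← mul_neg_geom_sum Y (g + d), ← mul_neg_geom_sum Y d]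
    ring
  have hrad : X - 1 ∈ J.radical ∧ ((e * g + e * d + c * g : ℕ) : A) ∈ J.radical := by
    have : ∀ P : Ideal A, J ≤ P → P.IsPrime →
        X - 1 ∈ P ∧ ((e * g + e * d + c * g : ℕ) : A) ∈ P := by
      intro P hJP hP
      have hα' := Ideal.Quotient.eq_zero_iff_mem.2 (hJP hαJ)
      have hβ' := Ideal.Quotient.eq_zero_iff_mem.2 (hJP hβJ)
      have hp' := Ideal.Quotient.eq_zero_iff_mem.2 (hJP hpJ)
      simp only [map_mul, map_sub, map_pow, map_one, map_sum] at hα' hβ' hp'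
      obtain ⟨hx1, hy1⟩ := pow_factorial_eq_one he hg hc hα' hβ'
      rw [← hMdef, ← map_pow] at hx1 hy1
      rw [hx1, hy1] at hp'
      constructor
      · rw [← Ideal.Quotient.eq_zero_iff_mem, map_sub, hx1, map_one, sub_self]
      · rw [← Ideal.Quotient.eq_zero_iff_mem, map_natCast, ← hp']
        simp
        ring
    simp only [Ideal.radical_eq_sInf, Submodule.mem_sInf, Set.mem_ofPred_eq]
    exact ⟨fun P hP => (this P hP.1 hP.2).1, fun P hP => (this P hP.1 hP.2).2⟩
  have hnil : ∀ z ∈ J.radical, IsNilpotent (Ideal.Quotient.mk J z) := by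
    rintro z ⟨n, hn⟩
    exact ⟨n, by rw [← map_pow, Ideal.Quotient.eq_zero_iff_mem.2 hn]⟩
  obtain ⟨Q, hQ, hsumQ⟩ := exists_geom_sum_eq_zero (X := Ideal.Quotient.mk J X)
    (n := e * g + e * d + c * g) (by positivity)
    (by simpa using hnil _ hrad.1) (by simpa using hnil _ hrad.2)
  simp only [← map_pow, ← map_sum] at hsumQ
  rw [Ideal.Quotient.eq_zero_iff_mem, memJ] at hsumQ
  refine ⟨M * Q, by positivity, ?_⟩
  rw [pow_mul, pow_mul, ← mul_neg_geom_sum X Q, ← mul_neg_geom_sum Y Q]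
  linear_combination (∑ i ∈ range Q, Y ^ i) * hsumQ

/-- Indicator of the closed upper right quadrant with corner `v`. -/
noncomputable def quadrantInd (v p : ℝ × ℝ) : ℤ :=
  (if v.1 ≤ p.1 then 1 else 0) * (if v.2 ≤ p.2 then 1 else 0)

theorem rectIndZ_eq_quadrantInd {b1 b2 c1 c2 : ℝ} (hb : b1 ≤ b2) (hc : c1 ≤ c2) (p : ℝ × ℝ) :
    rectIndZ b1 b2 c1 c2 p = quadrantInd (b1, c1) p - quadrantInd (b2, c1) p -
      quadrantInd (b1, c2) p + quadrantInd (b2, c2) p := by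
  simp only [rectIndZ, quadrantInd]
  split_ifs <;> first | rfl | (exfalso; grind)

theorem quadrantInd_rescale {ρ : ℝ} (hρ : 0 < ρ) (v w p : ℝ × ℝ) :
    quadrantInd w ((p.1 - v.1) / ρ, (p.2 - v.2) / ρ) = quadrantInd (v + ρ • w) p := by
  simp only [quadrantInd, le_div_iff₀ hρ, le_sub_iff_add_le, Prod.fst_add, Prod.snd_add,
    Prod.smul_fst, Prod.smul_snd, smul_eq_mul, mul_comm ρ, add_comm v.1, add_comm v.2]

open AddMonoidAlgebra in
/-- Encodes a function by its corners: the monomial at `v` is the quadrant with corner `v`. -/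
noncomputable def cornerMap : AddMonoidAlgebra ℤ (ℝ × ℝ) →+ (ℝ × ℝ → ℤ) :=
  (Finsupp.linearCombination ℤ quadrantInd).toAddMonoidHom.comp
    (coeffAddEquiv (R := ℤ) (M := ℝ × ℝ)).toAddMonoidHom

theorem cornerMap_single (v : ℝ × ℝ) (n : ℤ) :
    cornerMap (AddMonoidAlgebra.single v n) = n • quadrantInd v := by
  simp [cornerMap]

theorem cornerMap_single_mul_mem {S : Set (AddMonoidAlgebra ℤ (ℝ × ℝ))}
    {C : Submodule ℤ (ℝ × ℝ → ℤ)}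
    (hS : ∀ f ∈ S, ∀ v, cornerMap (AddMonoidAlgebra.single v 1 * f) ∈ C)
    {f : AddMonoidAlgebra ℤ (ℝ × ℝ)} (hf : f ∈ Ideal.span S) : cornerMap f ∈ C := by
  suffices h : ∀ g, cornerMap (g * f) ∈ C by simpa using h 1
  induction hf using Submodule.span_induction with
  | mem f hf =>
    intro g
    induction g using AddMonoidAlgebra.induction_linear with
    | zero => simp
    | add g h hg hh => simpa [add_mul] using C.add_mem hg hh
    | single v n =>
      have : AddMonoidAlgebra.single v n = n • AddMonoidAlgebra.single v (1 : ℤ) := by simp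
      rw [this, smul_mul_assoc, map_zsmul]
      exact C.smul_mem n (hS f hf v)
  | zero => simp
  | add f g _ _ hf hg =>
    intro h
    simpa [mul_add] using C.add_mem (hf h) (hg h)
  | smul a f _ hf =>
    intro g
    simpa [mul_assoc] using hf (g * a)

/-- The tile obtained by removing a `c × d` rectangle from the upper right
corner of an `a × b` rectangle ℤ-shapetiles a square. -/
theorem notched_rectangle_shapetiles_square (a b c d : ℕ)
    (ha : 0 < a) (hb : 0 < b) (hc : 0 < c) (hd : 0 < d)
    (hca : c < a) (hdb : d < b) (T : ℝ × ℝ → ℤ)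
    (hT : ∀ p, T p = rectIndZ 0 a 0 b p -
      rectIndZ ((a : ℝ) - c) a ((b : ℝ) - d) b p) :
    ZShapeTilesSquare T := by
  obtain ⟨e, he, rfl⟩ : ∃ e, 0 < e ∧ a = e + c := ⟨a - c, by omega, by omega⟩
  obtain ⟨g, hg, rfl⟩ : ∃ g, 0 < g ∧ b = g + d := ⟨b - d, by omega, by omega⟩
  set x : AddMonoidAlgebra ℤ (ℝ × ℝ) := AddMonoidAlgebra.single (1, 0) 1 with hx
  set y : AddMonoidAlgebra ℤ (ℝ × ℝ) := AddMonoidAlgebra.single (0, 1) 1 with hy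
  have hmon : ∀ v : ℝ × ℝ, ∀ i j : ℕ, AddMonoidAlgebra.single v 1 * (x ^ i * y ^ j) =
      AddMonoidAlgebra.single (v + ((i : ℝ), (j : ℝ))) 1 := by
    intro v i j
    simp [hx, hy, AddMonoidAlgebra.single_pow, AddMonoidAlgebra.single_mul_single]
  have hcorner : ∀ v : ℝ × ℝ, ∀ i j : ℕ,
      cornerMap (AddMonoidAlgebra.single v 1 * (x ^ i * y ^ j)) =
        quadrantInd (v + ((i : ℝ), (j : ℝ))) := by
    intro v i j
    rw [hmon, cornerMap_single, one_smul]
  set tile : ℕ → AddMonoidAlgebra ℤ (ℝ × ℝ) := fun k =>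
    (1 - x ^ (k * (e + c))) * (1 - y ^ (k * (g + d))) -
      x ^ (k * e) * y ^ (k * g) * ((1 - x ^ (k * c)) * (1 - y ^ (k * d))) with htile
  have htileMap : ∀ k, 0 < k → ∀ v, cornerMap (AddMonoidAlgebra.single v 1 * tile k) =
      fun p => T ((p.1 - v.1) / k, (p.2 - v.2) / k) := by
    intro k hk v
    have hexp : AddMonoidAlgebra.single v 1 * tile k =
        AddMonoidAlgebra.single v 1 * (x ^ 0 * y ^ 0)
        - AddMonoidAlgebra.single v 1 * (x ^ (k * (e + c)) * y ^ 0)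
        - AddMonoidAlgebra.single v 1 * (x ^ 0 * y ^ (k * (g + d)))
        + AddMonoidAlgebra.single v 1 * (x ^ (k * (e + c)) * y ^ (k * g))
        + AddMonoidAlgebra.single v 1 * (x ^ (k * e) * y ^ (k * (g + d)))
        - AddMonoidAlgebra.single v 1 * (x ^ (k * e) * y ^ (k * g)) := by
      simp only [htile]
      ring
    funext p
    have hk' : (0 : ℝ) < k := by exact_mod_cast hk
    rw [hexp, hT, rectIndZ_eq_quadrantInd (by positivity) (by positivity),
      rectIndZ_eq_quadrantInd (by simp) (by simp)]
    simp only [map_sub, map_add, hcorner, quadrantInd_rescale hk', Pi.sub_apply, Pi.add_apply,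
      Prod.smul_mk, smul_eq_mul, Nat.cast_mul, Nat.cast_add, Nat.cast_zero, mul_zero,
      add_sub_cancel_right]
    ring
  set S : Set (AddMonoidAlgebra ℤ (ℝ × ℝ)) := {f | ∃ k, 0 < k ∧ f = tile k} with hS
  have hunit : IsUnit x := by
    refine IsUnit.of_mul_eq_one (AddMonoidAlgebra.single (-1, 0) 1) ?_
    simp [hx, AddMonoidAlgebra.single_mul_single, AddMonoidAlgebra.one_def, Prod.zero_eq_mk]
  obtain ⟨s, hs, hsq⟩ := exists_one_sub_pow_mul_one_sub_pow_eq_zero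
    (y := Ideal.Quotient.mk (Ideal.span S) y)
    (hunit.map (Ideal.Quotient.mk (Ideal.span S))) he hg hc (d := d) (by
      intro k hk
      have hk' : tile k ∈ S := ⟨k, hk, rfl⟩
      have := Ideal.Quotient.eq_zero_iff_mem.2 (Ideal.subset_span hk')
      simpa [htile] using this)
  have hsqS : (1 - x ^ s) * (1 - y ^ s) ∈ Ideal.span S := by
    rw [← Ideal.Quotient.eq_zero_iff_mem]
    simpa using hsq
  have hmem := cornerMap_single_mul_mem (C := Submodule.span ℤ
    {h | ∃ (ρ : ℝ) (v : ℝ × ℝ), 0 < ρ ∧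
      h = fun p => T ((p.1 - v.1) / ρ, (p.2 - v.2) / ρ)}) (by
    rintro f ⟨k, hk, rfl⟩ v
    exact Submodule.subset_span ⟨k, v, by exact_mod_cast hk, htileMap k hk v⟩) hsqS
  have hsquare : cornerMap ((1 - x ^ s) * (1 - y ^ s)) = rectIndZ 0 s 0 s := by
    have hexp : (1 - x ^ s) * (1 - y ^ s) =
        AddMonoidAlgebra.single 0 1 * (x ^ 0 * y ^ 0)
        - AddMonoidAlgebra.single 0 1 * (x ^ s * y ^ 0)
        - AddMonoidAlgebra.single 0 1 * (x ^ 0 * y ^ s)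
        + AddMonoidAlgebra.single 0 1 * (x ^ s * y ^ s) := by
      rw [← AddMonoidAlgebra.one_def]
      ring
    funext p
    rw [hexp, rectIndZ_eq_quadrantInd (by positivity) (by positivity)]
    simp only [map_sub, map_add, hcorner, Pi.sub_apply, Pi.add_apply, zero_add, Nat.cast_zero]
  rw [hsquare] at hmem
  obtain ⟨n, w, t, hsum⟩ := Submodule.mem_span_set'.1 hmem
  choose ρ v hρ ht using fun i => (t i).2
  refine ⟨s, by exact_mod_cast hs, n, w, ρ, v, hρ, fun p => ?_⟩
  rw [← hsum, Finset.sum_apply]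
  refine Finset.sum_congr rfl fun i _ => ?_
  rw [Pi.smul_apply, ht i, smul_eq_mul]
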